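/- Assume (H1), (H3) and (H4'), and suppose in addition that inf over θ ∈ Θ ∖ {θ₀} of g(θ) equals 0. Then for every m ≥ 1 there exists α_m > 0 such that for each α ∈ (0,α_m] there exist ρ ∈ Λ, T̃ > 0 and constants C̃₁, C̃₂ > 0 such that W_{ρ_α}(μP_t^{θ₀}, νP_t^{θ₀}) ≤ C̃₁ e^{−C̃₂ t} · W_{ρ_{α/m}}(μ,ν) for every t ≥ T̃ and all Borel probability measures μ, ν on X satisfying ∫_X f dμ + ∫_X f dν < ∞, where f is the function from (H4'). -/

import Mathlib

open MeasureTheory ENNReal Filter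

noncomputable section

/-- A coupling of two Borel probability measures: a measure on the product whose
marginals are the given measures. -/
def IsCoupling {X : Type*} [MeasurableSpace X] (μ ν : Measure X)
    (Γ : Measure (X × X)) : Prop :=
  Γ.map Prod.fst = μ ∧ Γ.map Prod.snd = ν

/-- The Wasserstein-like extension of a distance-like function `ρ` to probability
measures: the infimum over couplings of the integral of `ρ`. -/
noncomputable def wassLike {X : Type*} [MeasurableSpace X] (ρ : X → X → ℝ)
    (μ ν : Measure X) : ℝ≥0∞ :=
  ⨅ (Γ : Measure (X × X)) (_ : IsProbabilityMeasure Γ) (_ : IsCoupling μ ν Γ),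
    ∫⁻ p, ENNReal.ofReal (ρ p.1 p.2) ∂Γ

/-- A distance-like function: nonnegative, symmetric, lower semicontinuous, and
vanishing exactly on the diagonal. -/
def DistanceLike {X : Type*} [TopologicalSpace X] (ρ : X → X → ℝ) : Prop :=
  (∀ u v, 0 ≤ ρ u v) ∧ (∀ u v, ρ u v = ρ v u) ∧
    LowerSemicontinuous (fun p : X × X => ρ p.1 p.2) ∧
    (∀ u v, ρ u v = 0 ↔ u = v)

/-- A Markov kernel given as a measurable family of probability measures. -/
def IsMarkovKernelFun {X : Type*} [MeasurableSpace X] (P : X → Measure X) : Prop :=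
  Measurable P ∧ ∀ u, IsProbabilityMeasure (P u)

/-- The weighted distance-like function `ρ_a(u,v) = ρ(u,v)^{1/2} exp(a‖u‖² + a‖v‖²)`. -/
noncomputable def expWeight {X : Type*} [NormedAddCommGroup X]
    (ρ : X → X → ℝ) (a : ℝ) (u v : X) : ℝ :=
  Real.sqrt (ρ u v) * Real.exp (a * ‖u‖ ^ 2 + a * ‖v‖ ^ 2)

open ProbabilityTheory Topology

section Wasserstein

variable {X : Type*} [MeasurableSpace X]

lemma wassLike_le {ρ : X → X → ℝ} {μ ν : Measure X} {Γ : Measure (X × X)}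
    [IsProbabilityMeasure Γ] (hΓ : IsCoupling μ ν Γ) :
    wassLike ρ μ ν ≤ ∫⁻ p, ENNReal.ofReal (ρ p.1 p.2) ∂Γ :=
  iInf_le_of_le Γ (iInf_le_of_le ‹_› (iInf_le_of_le hΓ le_rfl))

lemma exists_coupling_of_wassLike_lt {ρ : X → X → ℝ} {μ ν : Measure X} {r : ℝ≥0∞}
    (h : wassLike ρ μ ν < r) :
    ∃ Γ : Measure (X × X), IsProbabilityMeasure Γ ∧ IsCoupling μ ν Γ ∧
      ∫⁻ p, ENNReal.ofReal (ρ p.1 p.2) ∂Γ < r := by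
  simp only [wassLike, iInf_lt_iff] at h
  obtain ⟨Γ, h1, h2, h3⟩ := h
  exact ⟨Γ, h1, h2, h3⟩

lemma wassLike_comm_le {ρ : X → X → ℝ} (hsymm : ∀ u v, ρ u v = ρ v u)
    (hm : Measurable fun p : X × X => ρ p.1 p.2) (μ ν : Measure X) :
    wassLike ρ ν μ ≤ wassLike ρ μ ν := by
  refine le_iInf fun Γ => le_iInf fun _ => le_iInf fun hΓ => ?_
  have : IsProbabilityMeasure (Γ.map Prod.swap) :=
    Measure.isProbabilityMeasure_map measurable_swap.aemeasurable
  have hc : IsCoupling ν μ (Γ.map Prod.swap) := by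
    constructor
    · rw [Measure.map_map measurable_fst measurable_swap]; exact hΓ.2
    · rw [Measure.map_map measurable_snd measurable_swap]; exact hΓ.1
  refine (wassLike_le hc).trans (le_of_eq ?_)
  rw [lintegral_map hm.ennreal_ofReal measurable_swap]
  simp only [Prod.fst_swap, Prod.snd_swap, hsymm]

/-- Gluing of two couplings along their common marginal. -/
lemma exists_glued_coupling [StandardBorelSpace X] {μ ν η : Measure X}
    {Γ₁ Γ₂ : Measure (X × X)} [IsProbabilityMeasure Γ₁] [IsProbabilityMeasure Γ₂]
    (h₁ : IsCoupling μ ν Γ₁) (h₂ : IsCoupling ν η Γ₂) :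
    ∃ Δ : Measure ((X × X) × X), IsProbabilityMeasure Δ ∧ Δ.map Prod.fst = Γ₁ ∧
      Δ.map (fun p => (p.1.2, p.2)) = Γ₂ := by
  have : Nonempty X := by
    obtain ⟨p⟩ := nonempty_of_isProbabilityMeasure Γ₁
    exact ⟨p.1⟩
  refine ⟨Γ₁ ⊗ₘ (Γ₂.condKernel.comap Prod.snd measurable_snd), inferInstance, ?_, ?_⟩
  · exact Measure.fst_compProd _ _
  · have hΓ : Γ₂.fst ⊗ₘ Γ₂.condKernel = Γ₂ := Γ₂.disintegrate _
    have hm : Γ₂.fst = Γ₁.map Prod.snd := h₂.1.trans h₁.2.symm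
    have hmeas : Measurable fun p : (X × X) × X => (p.1.2, p.2) := by fun_prop
    conv_rhs => rw [← hΓ]
    ext s hs
    rw [Measure.map_apply hmeas hs, Measure.compProd_apply (hmeas hs), Measure.compProd_apply hs,
      hm, lintegral_map (Kernel.measurable_kernel_prodMk_left hs) measurable_snd]
    rfl

/-- A pointwise generalized triangle inequality passes to the Wasserstein-like extensions. -/
lemma wassLike_le_of_triangle [StandardBorelSpace X] {ρ a b : X → X → ℝ} {C : ℝ} (hC : 0 < C)
    (hρ : Measurable fun p : X × X => ρ p.1 p.2)
    (ha : Measurable fun p : X × X => a p.1 p.2) (hb : Measurable fun p : X × X => b p.1 p.2)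
    (h : ∀ u v w, ρ u v ≤ C * (a u w + b w v)) (μ ν η : Measure X) :
    wassLike ρ μ η ≤ ENNReal.ofReal C * (wassLike a μ ν + wassLike b ν η) := by
  by_cases htop : wassLike a μ ν + wassLike b ν η = ⊤
  · rw [htop, ENNReal.mul_top (by simpa using hC)]
    exact le_top
  rw [ENNReal.add_eq_top, not_or] at htop
  have key : ∀ δ : ℝ≥0∞, δ ≠ 0 →
      wassLike ρ μ η ≤ ENNReal.ofReal C * ((wassLike a μ ν + δ) + (wassLike b ν η + δ)) := by
    intro δ hδ
    obtain ⟨Γ₁, _, h₁, hl₁⟩ := exists_coupling_of_wassLike_lt (ENNReal.lt_add_right htop.1 hδ)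
    obtain ⟨Γ₂, _, h₂, hl₂⟩ := exists_coupling_of_wassLike_lt (ENNReal.lt_add_right htop.2 hδ)
    obtain ⟨Δ, _, hΔ₁, hΔ₂⟩ := exists_glued_coupling h₁ h₂
    have hmeas : Measurable fun p : (X × X) × X => (p.1.1, p.2) := by fun_prop
    have hmeas' : Measurable fun p : (X × X) × X => (p.1.2, p.2) := by fun_prop
    have : IsProbabilityMeasure (Δ.map fun p => (p.1.1, p.2)) :=
      Measure.isProbabilityMeasure_map hmeas.aemeasurable
    have hc : IsCoupling μ η (Δ.map fun p => (p.1.1, p.2)) := by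
      constructor
      · rw [Measure.map_map measurable_fst hmeas, ← h₁.1, ← hΔ₁,
          Measure.map_map measurable_fst measurable_fst]; rfl
      · rw [Measure.map_map measurable_snd hmeas, ← h₂.2, ← hΔ₂,
          Measure.map_map measurable_snd hmeas']; rfl
    calc wassLike ρ μ η ≤ ∫⁻ p, ENNReal.ofReal (ρ p.1.1 p.2) ∂Δ := by
          refine (wassLike_le hc).trans (le_of_eq ?_)
          rw [lintegral_map hρ.ennreal_ofReal hmeas]
      _ ≤ ∫⁻ p, ENNReal.ofReal C *
            (ENNReal.ofReal (a p.1.1 p.1.2) + ENNReal.ofReal (b p.1.2 p.2)) ∂Δ := by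
          refine lintegral_mono fun p => (ENNReal.ofReal_le_ofReal (h p.1.1 p.2 p.1.2)).trans ?_
          rw [ENNReal.ofReal_mul hC.le]
          gcongr
          exact ENNReal.ofReal_add_le
      _ = ENNReal.ofReal C * (∫⁻ p, ENNReal.ofReal (a p.1 p.2) ∂Γ₁ +
            ∫⁻ p, ENNReal.ofReal (b p.1 p.2) ∂Γ₂) := by
          have ha' : Measurable fun p : (X × X) × X => ENNReal.ofReal (a p.1.1 p.1.2) :=
            ha.ennreal_ofReal.comp measurable_fst
          rw [lintegral_const_mul' _ _ ENNReal.ofReal_ne_top, lintegral_add_left ha', ← hΔ₁, ← hΔ₂,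
            lintegral_map ha.ennreal_ofReal measurable_fst,
            lintegral_map hb.ennreal_ofReal hmeas']
      _ ≤ _ := by gcongr
  have hlim : Tendsto (fun δ : ℝ≥0∞ => ENNReal.ofReal C *
      ((wassLike a μ ν + δ) + (wassLike b ν η + δ))) (𝓝[≠] 0)
      (𝓝 (ENNReal.ofReal C * ((wassLike a μ ν + 0) + (wassLike b ν η + 0)))) := by
    refine ENNReal.Tendsto.const_mul ?_ (Or.inr ENNReal.ofReal_ne_top)
    refine Tendsto.mono_left ?_ nhdsWithin_le_nhds
    exact Continuous.tendsto (by fun_prop) 0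
  simp only [add_zero] at hlim
  exact ge_of_tendsto hlim (eventually_nhdsWithin_of_forall key)

end Wasserstein

section WeakConvergence

variable {X : Type*} [TopologicalSpace X] [MeasurableSpace X]

/-- Convergence on all finite unions of basic open sets implies weak convergence. -/
lemma tendsto_of_tendsto_finite_union_basis [SecondCountableTopology X] [OpensMeasurableSpace X]
    {μ : ProbabilityMeasure X} {μs : ℕ → ProbabilityMeasure X}
    (h : ∀ s : Finset (TopologicalSpace.countableBasis X),
      Tendsto (fun n => (μs n : Measure X) (⋃ b ∈ s, (b : Set X))) atTop
        (𝓝 ((μ : Measure X) (⋃ b ∈ s, (b : Set X))))) :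
    Tendsto μs atTop (𝓝 μ) := by
  refine tendsto_of_forall_isOpen_le_liminf' fun G hG => ?_
  let I := {s : Finset (TopologicalSpace.countableBasis X) // ⋃ b ∈ s, (b : Set X) ⊆ G}
  have : Countable (TopologicalSpace.countableBasis X) :=
    (TopologicalSpace.countable_countableBasis X).to_subtype
  have hunion : G = ⋃ s : I, ⋃ b ∈ s.1, (b : Set X) := by
    refine Set.Subset.antisymm (fun x hx => ?_) (Set.iUnion_subset fun s => s.2)
    obtain ⟨b, hb, hxb, hbG⟩ :=
      (TopologicalSpace.isBasis_countableBasis X).exists_subset_of_mem_open hx hG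
    refine Set.mem_iUnion.2 ⟨⟨{⟨b, hb⟩}, by simpa using hbG⟩, by simpa using hxb⟩
  have hdir : Directed (· ⊆ ·) fun s : I => ⋃ b ∈ s.1, (b : Set X) := by
    classical
    intro s t
    refine ⟨⟨s.1 ∪ t.1, ?_⟩, ?_, ?_⟩
    · rw [Finset.set_biUnion_union]
      exact Set.union_subset s.2 t.2
    · exact Set.biUnion_subset_biUnion_left fun b hb => Finset.mem_union_left _ hb
    · exact Set.biUnion_subset_biUnion_left fun b hb => Finset.mem_union_right _ hb
  conv_lhs => rw [hunion, hdir.measure_iUnion]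
  refine iSup_le fun s => ?_
  rw [← (h s.1).liminf_eq]
  exact liminf_le_liminf (Eventually.of_forall fun n => measure_mono s.2)

lemma lintegral_le_liminf_of_lowerSemicontinuous [OpensMeasurableSpace X]
    [HasOuterApproxClosed X]
    {μ : ProbabilityMeasure X} {μs : ℕ → ProbabilityMeasure X} (hμ : Tendsto μs atTop (𝓝 μ))
    {c : X → ℝ} (hc : LowerSemicontinuous c) (hc0 : 0 ≤ c) :
    ∫⁻ x, ENNReal.ofReal (c x) ∂(μ : Measure X) ≤
      atTop.liminf fun n => ∫⁻ x, ENNReal.ofReal (c x) ∂(μs n : Measure X) := by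
  simp_rw [lintegral_eq_lintegral_meas_lt _ (Eventually.of_forall hc0) hc.measurable.aemeasurable]
  refine (lintegral_mono fun t => ProbabilityMeasure.le_liminf_measure_open_of_tendsto hμ
    (hc.isOpen_preimage t)).trans ?_
  exact lintegral_liminf_le fun n => Antitone.measurable fun s t hst =>
    measure_mono fun x hx => lt_of_le_of_lt hst hx

lemma isTightMeasureSet_range_of_tendsto [PolishSpace X] [BorelSpace X]
    {μ : ProbabilityMeasure X} {μs : ℕ → ProbabilityMeasure X} (h : Tendsto μs atTop (𝓝 μ)) :
    IsTightMeasureSet {((ν : ProbabilityMeasure X) : Measure X) | ν ∈ Set.range μs} := by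
  let := TopologicalSpace.upgradeIsCompletelyMetrizable X
  refine isTightMeasureSet_of_isCompact_closure ?_
  refine h.isCompact_insert_range.of_isClosed_subset isClosed_closure ?_
  exact closure_minimal (Set.subset_insert _ _) h.isCompact_insert_range.isClosed

/-- Couplings of weakly convergent marginals subconverge to a coupling of the limits. -/
lemma exists_subseq_tendsto_coupling [PolishSpace X] [BorelSpace X]
    {μ ν : ProbabilityMeasure X} {μs νs : ℕ → ProbabilityMeasure X}
    (hμ : Tendsto μs atTop (𝓝 μ)) (hν : Tendsto νs atTop (𝓝 ν))
    {Γs : ℕ → ProbabilityMeasure (X × X)}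
    (hΓ : ∀ n, IsCoupling (μs n : Measure X) (νs n) (Γs n : Measure (X × X))) :
    ∃ (Γ : ProbabilityMeasure (X × X)) (φ : ℕ → ℕ), StrictMono φ ∧
      Tendsto (Γs ∘ φ) atTop (𝓝 Γ) ∧ IsCoupling (μ : Measure X) ν (Γ : Measure (X × X)) := by
  have htight : IsTightMeasureSet
      {((Γ : ProbabilityMeasure (X × X)) : Measure (X × X)) | Γ ∈ Set.range Γs} := by
    rw [isTightMeasureSet_iff_exists_isCompact_measure_compl_le]
    intro ε hε
    obtain ⟨K₁, hK₁, hle₁⟩ := isTightMeasureSet_iff_exists_isCompact_measure_compl_le.1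
      (isTightMeasureSet_range_of_tendsto hμ) (ε / 2) (ENNReal.half_pos hε.ne')
    obtain ⟨K₂, hK₂, hle₂⟩ := isTightMeasureSet_iff_exists_isCompact_measure_compl_le.1
      (isTightMeasureSet_range_of_tendsto hν) (ε / 2) (ENNReal.half_pos hε.ne')
    refine ⟨K₁ ×ˢ K₂, hK₁.prod hK₂, ?_⟩
    rintro _ ⟨_, ⟨n, rfl⟩, rfl⟩
    have hsub : (K₁ ×ˢ K₂)ᶜ ⊆ Prod.fst ⁻¹' K₁ᶜ ∪ Prod.snd ⁻¹' K₂ᶜ := by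
      rw [Set.compl_prod_eq_union, Set.prod_univ, Set.univ_prod]
    calc (Γs n : Measure (X × X)) (K₁ ×ˢ K₂)ᶜ
        ≤ (Γs n : Measure (X × X)) (Prod.fst ⁻¹' K₁ᶜ)
          + (Γs n : Measure (X × X)) (Prod.snd ⁻¹' K₂ᶜ) :=
          (measure_mono hsub).trans (measure_union_le _ _)
      _ = (μs n : Measure X) K₁ᶜ + (νs n : Measure X) K₂ᶜ := by
          rw [← Measure.map_apply measurable_fst hK₁.measurableSet.compl,
            ← Measure.map_apply measurable_snd hK₂.measurableSet.compl, (hΓ n).1, (hΓ n).2]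
      _ ≤ ε / 2 + ε / 2 :=
          add_le_add (hle₁ _ ⟨_, ⟨n, rfl⟩, rfl⟩) (hle₂ _ ⟨_, ⟨n, rfl⟩, rfl⟩)
      _ = ε := ENNReal.add_halves ε
  obtain ⟨Γ, -, φ, hφ, hlim⟩ := (isCompact_closure_of_isTightMeasureSet htight).tendsto_subseq
    fun n => subset_closure ⟨n, rfl⟩
  refine ⟨Γ, φ, hφ, hlim, ?_, ?_⟩
  · have h₁ := ProbabilityMeasure.tendsto_map_of_tendsto_of_continuous _ _ hlim
      (continuous_fst (X := X) (Y := X))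
    have h₂ := tendsto_nhds_unique h₁ ((hμ.comp hφ.tendsto_atTop).congr fun n =>
      Subtype.ext (hΓ (φ n)).1.symm)
    exact congrArg Subtype.val h₂
  · have h₁ := ProbabilityMeasure.tendsto_map_of_tendsto_of_continuous _ _ hlim
      (continuous_snd (X := X) (Y := X))
    have h₂ := tendsto_nhds_unique h₁ ((hν.comp hφ.tendsto_atTop).congr fun n =>
      Subtype.ext (hΓ (φ n)).2.symm)
    exact congrArg Subtype.val h₂

end WeakConvergence

section Mixtures

lemma exists_countable_approx {Y E : Type*} [MeasurableSpace Y] [PseudoMetricSpace E]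
    [SecondCountableTopology E] [MeasurableSpace E] [OpensMeasurableSpace E] {F : Y → E}
    (hF : Measurable F) {S : Set Y} (hSm : MeasurableSet S) (hS : S.Nonempty) {ε : ℕ → ℝ}
    (hε : ∀ n, 0 < ε n) :
    ∃ (y : ℕ → Y) (i : ℕ → Y → ℕ), (∀ j, y j ∈ S) ∧ (∀ n, Measurable (i n)) ∧
      ∀ n, ∀ x ∈ S, dist (F (y (i n x))) (F x) < ε n := by
  classical
  have : Nonempty (F '' S) := (hS.image F).to_subtype
  obtain ⟨d, hd⟩ := TopologicalSpace.exists_dense_seq (F '' S)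
  choose y hyS hy using fun j => (d j).2
  have hex : ∀ n x, ∃ j, x ∈ Sᶜ ∨ dist (F (y j)) (F x) < ε n := by
    intro n x
    by_cases hx : x ∈ S
    · obtain ⟨j, hj⟩ := hd.exists_dist_lt ⟨F x, x, hx, rfl⟩ (hε n)
      refine ⟨j, Or.inr ?_⟩
      rw [hy, dist_comm]
      exact hj
    · exact ⟨0, Or.inl hx⟩
  refine ⟨y, fun n x => Nat.find (hex n x), hyS, fun n => measurable_find _ fun j => ?_,
    fun n x hx => ?_⟩
  · exact hSm.compl.union
      (measurableSet_lt (measurable_const.dist hF) measurable_const)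
  · exact (Nat.find_spec (hex n x)).resolve_left fun h => h hx

lemma isProbabilityMeasure_bind_of_forall {Y X : Type*} [MeasurableSpace Y] [MeasurableSpace X]
    {μ : Measure Y} [IsProbabilityMeasure μ] {P : Y → Measure X} (hP : Measurable P)
    (hP1 : ∀ y, IsProbabilityMeasure (P y)) : IsProbabilityMeasure (μ.bind P) :=
  ⟨by simp [Measure.bind_apply MeasurableSet.univ hP.aemeasurable]⟩

lemma map_bind_of_measurable {Y X Z : Type*} [MeasurableSpace Y] [MeasurableSpace X]
    [MeasurableSpace Z] {μ : Measure Y} {P : Y → Measure X} (hP : Measurable P) {f : X → Z}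
    (hf : Measurable f) : (μ.bind P).map f = μ.bind fun y => (P y).map f := by
  ext s hs
  rw [Measure.map_apply hf hs, Measure.bind_apply (hf hs) hP.aemeasurable,
    Measure.bind_apply (f := fun y => (P y).map f) hs
      ((Measure.measurable_map f hf).comp hP).aemeasurable]
  simp only [Measure.map_apply hf hs]

variable {Y X : Type*} [MeasurableSpace Y] [TopologicalSpace X] [PolishSpace X]
  [MeasurableSpace X] [BorelSpace X]

/-- Convexity of the Wasserstein-like extension of a lower semicontinuous cost. The mixtures are
approximated by countable ones, so that no measurable selection of couplings is needed. -/
lemma wassLike_bind_le {c : X → X → ℝ} (hc : LowerSemicontinuous fun p : X × X => c p.1 p.2)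
    (hc0 : ∀ u v, 0 ≤ c u v) {P Q : Y → Measure X} (hP : Measurable P)
    (hP1 : ∀ y, IsProbabilityMeasure (P y)) (hQ : Measurable Q)
    (hQ1 : ∀ y, IsProbabilityMeasure (Q y)) {h : Y → ℝ≥0∞} (hh : Measurable h)
    (hle : ∀ y, wassLike c (P y) (Q y) ≤ h y) (μ : Measure Y) [IsProbabilityMeasure μ] :
    wassLike c (μ.bind P) (μ.bind Q) ≤ ∫⁻ y, h y ∂μ := by
  by_cases htop : ∫⁻ y, h y ∂μ = ⊤
  · exact htop ▸ le_top
  set S : Set Y := {y | h y < ⊤}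
  have hSm : MeasurableSet S := measurableSet_lt hh measurable_const
  have hSae : ∀ᵐ y ∂μ, y ∈ S := ae_lt_top hh htop
  have hS : S.Nonempty := hSae.exists
  let B := TopologicalSpace.countableBasis X
  have : Countable B := (TopologicalSpace.countable_countableBasis X).to_subtype
  have hopen : ∀ s : Finset B, MeasurableSet (⋃ b ∈ s, (b : Set X)) := fun s =>
    (isOpen_biUnion fun b _ => TopologicalSpace.isOpen_of_mem_countableBasis b.2).measurableSet
  let := TopologicalSpace.pseudoMetrizableSpacePseudoMetric (Finset B → ℝ)
  let F : Y → ((Finset B → ℝ) × (Finset B → ℝ)) × ℝ := fun y =>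
    ((fun s => (P y (⋃ b ∈ s, (b : Set X))).toReal,
      fun s => (Q y (⋃ b ∈ s, (b : Set X))).toReal), (h y).toReal)
  have hF : Measurable F := by
    refine Measurable.prodMk (Measurable.prodMk ?_ ?_) hh.ennreal_toReal
    · exact measurable_pi_lambda _ fun s =>
        ((Measure.measurable_coe (hopen s)).comp hP).ennreal_toReal
    · exact measurable_pi_lambda _ fun s =>
        ((Measure.measurable_coe (hopen s)).comp hQ).ennreal_toReal
  let ε : ℕ → ℝ := fun n => 1 / ((n : ℝ) + 1)
  have hε : ∀ n, 0 < ε n := fun n => Nat.one_div_pos_of_nat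
  have hε0 : Tendsto ε atTop (𝓝 0) := tendsto_one_div_add_atTop_nhds_zero_nat
  obtain ⟨y, i, hyS, hi, hdist⟩ := exists_countable_approx hF hSm hS hε
  have hlimF : ∀ x ∈ S, Tendsto (fun n => F (y (i n x))) atTop (𝓝 (F x)) := fun x hx =>
    tendsto_iff_dist_tendsto_zero.2
      (squeeze_zero (fun _ => dist_nonneg) (fun n => (hdist n x hx).le) hε0)
  have hcoup : ∀ n j, ∃ Γ : Measure (X × X), IsProbabilityMeasure Γ ∧
      IsCoupling (P (y j)) (Q (y j)) Γ ∧
      ∫⁻ p, ENNReal.ofReal (c p.1 p.2) ∂Γ < h (y j) + ENNReal.ofReal (ε n) := fun n j =>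
    exists_coupling_of_wassLike_lt ((hle (y j)).trans_lt
      (ENNReal.lt_add_right (hyS j).ne (by simpa using hε n)))
  choose Γ hΓ1 hΓc hΓl using hcoup
  have hyi : ∀ n, Measurable fun x => y (i n x) := fun n =>
    (measurable_from_nat (f := y)).comp (hi n)
  have hΓm : ∀ n, Measurable fun x => Γ n (i n x) := fun n =>
    (measurable_from_nat (f := Γ n)).comp (hi n)
  have hbind : ∀ {R : Y → Measure X}, Measurable R → (∀ y, IsProbabilityMeasure (R y)) →
      (∀ (s : Finset B), ∀ x ∈ S,
        Tendsto (fun n => (R (y (i n x)) (⋃ b ∈ s, (b : Set X))).toReal) atTop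
          (𝓝 (R x (⋃ b ∈ s, (b : Set X))).toReal)) →
      ∀ s : Finset B, Tendsto (fun n => (μ.bind fun x => R (y (i n x))) (⋃ b ∈ s, (b : Set X)))
        atTop (𝓝 (μ.bind R (⋃ b ∈ s, (b : Set X)))) := by
    intro R hR hR1 hlim s
    rw [Measure.bind_apply (hopen s) hR.aemeasurable]
    have hRn : ∀ n, (μ.bind fun x => R (y (i n x))) (⋃ b ∈ s, (b : Set X)) =
        ∫⁻ x, R (y (i n x)) (⋃ b ∈ s, (b : Set X)) ∂μ := fun n =>
      Measure.bind_apply (hopen s) (hR.comp (hyi n)).aemeasurable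
    simp only [hRn]
    refine tendsto_lintegral_of_dominated_convergence (fun _ => 1)
      (fun n => (Measure.measurable_coe (hopen s)).comp (hR.comp (hyi n)))
      (fun n => Eventually.of_forall fun x => prob_le_one) (by simp) ?_
    filter_upwards [hSae] with x hx
    exact (ENNReal.tendsto_toReal_iff (fun _ => measure_ne_top _ _) (measure_ne_top _ _)).1
      (hlim s x hx)
  have hprob : ∀ {R : Y → Measure X}, Measurable R → (∀ y, IsProbabilityMeasure (R y)) →
      ∀ n, IsProbabilityMeasure (μ.bind fun x => R (y (i n x))) := fun hR hR1 n =>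
    isProbabilityMeasure_bind_of_forall (hR.comp (hyi n)) fun x => hR1 _
  let μs : ℕ → ProbabilityMeasure X := fun n => ⟨_, hprob hP hP1 n⟩
  let νs : ℕ → ProbabilityMeasure X := fun n => ⟨_, hprob hQ hQ1 n⟩
  let Γs : ℕ → ProbabilityMeasure (X × X) := fun n =>
    ⟨_, isProbabilityMeasure_bind_of_forall (μ := μ) (hΓm n) fun x => hΓ1 n _⟩
  let μ' : ProbabilityMeasure X := ⟨_, isProbabilityMeasure_bind_of_forall (μ := μ) hP hP1⟩
  let ν' : ProbabilityMeasure X := ⟨_, isProbabilityMeasure_bind_of_forall (μ := μ) hQ hQ1⟩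
  have hμs : Tendsto μs atTop (𝓝 μ') := tendsto_of_tendsto_finite_union_basis <|
    hbind hP hP1 fun s x hx => tendsto_pi_nhds.1 (hlimF x hx).fst_nhds.fst_nhds s
  have hνs : Tendsto νs atTop (𝓝 ν') := tendsto_of_tendsto_finite_union_basis <|
    hbind hQ hQ1 fun s x hx => tendsto_pi_nhds.1 (hlimF x hx).fst_nhds.snd_nhds s
  have hcoupl : ∀ n, IsCoupling (μs n : Measure X) (νs n) (Γs n : Measure (X × X)) := by
    intro n
    constructor
    · refine (map_bind_of_measurable (hΓm n) measurable_fst).trans ?_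
      simp only [(hΓc n _).1]
      rfl
    · refine (map_bind_of_measurable (hΓm n) measurable_snd).trans ?_
      simp only [(hΓc n _).2]
      rfl
  obtain ⟨Γ', φ, hφ, hlim, hc'⟩ := exists_subseq_tendsto_coupling hμs hνs hcoupl
  have hcost : ∀ n, ∫⁻ p, ENNReal.ofReal (c p.1 p.2) ∂(Γs n : Measure (X × X)) ≤
      (∫⁻ x, h x ∂μ) + (ENNReal.ofReal (ε n) + ENNReal.ofReal (ε n)) := by
    intro n
    have hpt : ∀ x ∈ S, h (y (i n x)) ≤ h x + ENNReal.ofReal (ε n) := by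
      intro x hx
      have h1 : dist (h (y (i n x))).toReal (h x).toReal < ε n :=
        (le_max_right _ _).trans_lt (hdist n x hx)
      rw [← ENNReal.ofReal_toReal (hyS (i n x)).ne, ← ENNReal.ofReal_toReal (show h x ≠ ⊤ from hx.ne),
        ← ENNReal.ofReal_add ENNReal.toReal_nonneg (hε n).le]
      refine ENNReal.ofReal_le_ofReal ?_
      linarith [(abs_lt.1 h1).2]
    calc ∫⁻ p, ENNReal.ofReal (c p.1 p.2) ∂(Γs n : Measure (X × X))
        = ∫⁻ x, ∫⁻ p, ENNReal.ofReal (c p.1 p.2) ∂(Γ n (i n x)) ∂μ :=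
          Measure.lintegral_bind (hΓm n).aemeasurable hc.measurable.ennreal_ofReal.aemeasurable
      _ ≤ ∫⁻ x, (h x + (ENNReal.ofReal (ε n) + ENNReal.ofReal (ε n))) ∂μ := by
          refine lintegral_mono_ae ?_
          filter_upwards [hSae] with x hx
          refine (hΓl n (i n x)).le.trans ?_
          rw [← add_assoc]
          gcongr
          exact hpt x hx
      _ = _ := by simp [lintegral_add_left hh]
  have hlsc := lintegral_le_liminf_of_lowerSemicontinuous hlim hc fun p => hc0 p.1 p.2
  refine (wassLike_le hc').trans (hlsc.trans ?_)
  have hbound : Tendsto (fun n => (∫⁻ x, h x ∂μ) +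
      (ENNReal.ofReal (ε (φ n)) + ENNReal.ofReal (ε (φ n)))) atTop (𝓝 (∫⁻ x, h x ∂μ)) := by
    have h1 := ENNReal.tendsto_ofReal (hε0.comp hφ.tendsto_atTop)
    simpa using tendsto_const_nhds (x := ∫⁻ x, h x ∂μ) |>.add (h1.add h1)
  rw [← hbound.liminf_eq]
  exact liminf_le_liminf (Eventually.of_forall fun n => hcost (φ n))

end Mixtures

section ExpWeight

variable {X : Type*} [NormedAddCommGroup X]

lemma expWeight_nonneg (ρ : X → X → ℝ) (a : ℝ) (u v : X) : 0 ≤ expWeight ρ a u v :=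
  mul_nonneg (Real.sqrt_nonneg _) (Real.exp_pos _).le

lemma expWeight_symm {ρ : X → X → ℝ} (hρ : ∀ u v, ρ u v = ρ v u) (a : ℝ) (u v : X) :
    expWeight ρ a u v = expWeight ρ a v u := by
  rw [expWeight, expWeight, hρ u v, add_comm]

lemma lowerSemicontinuous_expWeight {ρ : X → X → ℝ}
    (hρ : LowerSemicontinuous fun p : X × X => ρ p.1 p.2) (a : ℝ) :
    LowerSemicontinuous fun p : X × X => expWeight ρ a p.1 p.2 := by
  have hsqrt : LowerSemicontinuous fun p : X × X => Real.sqrt (ρ p.1 p.2) :=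
    Real.continuous_sqrt.comp_lowerSemicontinuous hρ fun _ _ h => Real.sqrt_le_sqrt h
  intro p t ht
  let e : X × X → ℝ := fun q => Real.exp (a * ‖q.1‖ ^ 2 + a * ‖q.2‖ ^ 2)
  have he : Continuous e := by fun_prop
  have hpos : ∀ q, 0 < e q := fun q => Real.exp_pos _
  have ht' : t / e p < Real.sqrt (ρ p.1 p.2) := (div_lt_iff₀ (hpos p)).2 ht
  obtain ⟨r, hr₁, hr₂⟩ := exists_between ht'
  have hcont : Tendsto (fun q => t / e q) (𝓝 p) (𝓝 (t / e p)) :=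
    tendsto_const_nhds.div he.continuousAt (hpos p).ne'
  filter_upwards [hsqrt p r hr₂, hcont.eventually_lt_const hr₁] with q hq₁ hq₂
  exact (div_lt_iff₀ (hpos q)).1 (hq₂.trans hq₁)

end ExpWeight

/-- Lemma 2.5 (lem:sp:gap:lim:sys): under (H1), (H3) and (H4') with
`inf_{θ ≠ θ₀} g(θ) = 0`, the limit semigroup `P^{θ₀}` satisfies an exponential
Wasserstein contraction on measures with finite `f`-moment. -/
theorem limit_semigroup_contraction
    {X : Type*} [NormedAddCommGroup X] [NormedSpace ℝ X] [CompleteSpace X]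
    [SecondCountableTopology X] [MeasurableSpace X] [BorelSpace X]
    {Θ : Type*} (θ₀ : Θ)
    (P : Θ → ℝ → X → Measure X)
    (hker : ∀ θ : Θ, ∀ t ≥ (0 : ℝ), IsMarkovKernelFun (P θ t))
    (Λ : Set (X → X → ℝ))
    (hΛ : ∀ ρ ∈ Λ, DistanceLike ρ ∧ ∀ u v : X, ρ u v ≤ 1)
    -- (H1) generalized triangle inequality for the weighted distances
    (γ : ℝ) (hγ : 1 ≤ γ)
    (hH1 : ∀ ρ ∈ Λ, ∀ α > (0 : ℝ), ∃ C > (0 : ℝ), ∀ u v w : X,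
      expWeight ρ α u v ≤ C * (expWeight ρ (γ * α) u w + expWeight ρ (γ * α) w v))
    -- (H3) parameter-uniform Wasserstein contraction
    (hH3 : ∀ m : ℝ, 1 ≤ m → ∃ αm > (0 : ℝ), ∀ α ∈ Set.Ioc (0 : ℝ) αm, ∃ ρ ∈ Λ,
      ∃ T > (0 : ℝ), ∃ C₁ > (0 : ℝ), ∃ C₂ > (0 : ℝ), ∀ θ : Θ, θ ≠ θ₀ → ∀ t ≥ T,
        ∀ μ ν : Measure X, IsProbabilityMeasure μ → IsProbabilityMeasure ν →
          wassLike (expWeight ρ α) (μ.bind (P θ t)) (ν.bind (P θ t))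
            ≤ ENNReal.ofReal (C₁ * Real.exp (-C₂ * t))
              * wassLike (expWeight ρ (α / m)) μ ν)
    -- (H4') finite-time error estimate
    (α' : ℝ) (hα' : 0 < α')
    (g : Θ → ℝ) (hg0 : ∀ θ, 0 ≤ g θ)
    (φt : ℝ → ℝ) (hφt0 : ∀ t ≥ (0 : ℝ), 0 ≤ φt t)
    (f : X → ℝ≥0∞) (hf : Measurable f)
    (hH4 : ∀ ρ ∈ Λ, ∀ a ∈ Set.Ioc (0 : ℝ) α', ∀ θ : Θ, ∀ t ≥ (0 : ℝ), ∀ u : X,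
      wassLike (expWeight ρ a) (P θ t u) (P θ₀ t u)
        ≤ ENNReal.ofReal (φt t) * f u * ENNReal.ofReal (g θ))
    -- the infimum of g over Θ ∖ {θ₀} equals 0
    (hginf : ∀ ε > (0 : ℝ), ∃ θ : Θ, θ ≠ θ₀ ∧ g θ < ε) :
    ∀ m : ℝ, 1 ≤ m → ∃ αm > (0 : ℝ), ∀ α ∈ Set.Ioc (0 : ℝ) αm, ∃ ρ ∈ Λ,
      ∃ Ttil > (0 : ℝ), ∃ Ct₁ > (0 : ℝ), ∃ Ct₂ > (0 : ℝ), ∀ t ≥ Ttil,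
        ∀ μ ν : Measure X, IsProbabilityMeasure μ → IsProbabilityMeasure ν →
          (∫⁻ u, f u ∂μ) + (∫⁻ u, f u ∂ν) < ⊤ →
          wassLike (expWeight ρ α) (μ.bind (P θ₀ t)) (ν.bind (P θ₀ t))
            ≤ ENNReal.ofReal (Ct₁ * Real.exp (-Ct₂ * t))
              * wassLike (expWeight ρ (α / m)) μ ν := by
  intro m hm
  obtain ⟨αm, hαm, hcontr⟩ := hH3 (γ * γ * m)
    (one_le_mul_of_one_le_of_one_le (one_le_mul_of_one_le_of_one_le hγ hγ) hm)
  have hγ0 : 0 < γ := one_pos.trans_le hγ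
  refine ⟨min αm α' / (γ * γ), by positivity, fun α ⟨hα0, hα⟩ => ?_⟩
  rw [le_div_iff₀ (by positivity)] at hα
  have hβ : γ * (γ * α) ≤ min αm α' := by linarith
  obtain ⟨ρ, hρ, T, hT, C₁, hC₁, C₂, hC₂, hcontr⟩ :=
    hcontr (γ * (γ * α)) ⟨by positivity, hβ.trans (min_le_left _ _)⟩
  have hm0 : 0 < m := one_pos.trans_le hm
  have hdiv : γ * (γ * α) / (γ * γ * m) = α / m := by field_simp
  rw [hdiv] at hcontr
  obtain ⟨Ca, hCa, htria⟩ := hH1 ρ hρ α hα0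
  obtain ⟨Cb, hCb, htrib⟩ := hH1 ρ hρ (γ * α) (by positivity)
  obtain ⟨⟨-, hsymm, hlsc, -⟩, -⟩ := hΛ ρ hρ
  have hmeas : ∀ a, Measurable fun p : X × X => expWeight ρ a p.1 p.2 := fun a =>
    (lowerSemicontinuous_expWeight hlsc a).measurable
  refine ⟨ρ, hρ, T, hT, Ca * Cb * C₁, by positivity, C₂, hC₂, fun t ht μ ν _ _ hfin => ?_⟩
  have ht0 : 0 ≤ t := hT.le.trans ht
  have herr : ∀ a ∈ Set.Ioc 0 α', ∀ θ, ∀ η : Measure X, IsProbabilityMeasure η →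
      wassLike (expWeight ρ a) (η.bind (P θ t)) (η.bind (P θ₀ t)) ≤
        ENNReal.ofReal (φt t) * (∫⁻ u, f u ∂η) * ENNReal.ofReal (g θ) := by
    intro a ha θ η _
    refine (wassLike_bind_le (lowerSemicontinuous_expWeight hlsc a) (expWeight_nonneg ρ a)
      (hker θ t ht0).1 (hker θ t ht0).2 (hker θ₀ t ht0).1 (hker θ₀ t ht0).2
      ((hf.const_mul _).mul_const _) (hH4 ρ hρ a ha θ t ht0) η).trans (le_of_eq ?_)
    rw [lintegral_mul_const _ (hf.const_mul _), lintegral_const_mul _ hf]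
  have hbβ : γ * (γ * α) ∈ Set.Ioc 0 α' := ⟨by positivity, hβ.trans (min_le_right _ _)⟩
  have hbα : γ * α ∈ Set.Ioc 0 α' :=
    ⟨by positivity, (le_mul_of_one_le_left (by positivity) hγ).trans hbβ.2⟩
  have hstep : ∀ ε > (0 : ℝ), wassLike (expWeight ρ α) (μ.bind (P θ₀ t)) (ν.bind (P θ₀ t)) ≤
      ENNReal.ofReal Ca * (ENNReal.ofReal (φt t) * (∫⁻ u, f u ∂μ) * ENNReal.ofReal ε +
        ENNReal.ofReal Cb * (ENNReal.ofReal (C₁ * Real.exp (-C₂ * t)) *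
          wassLike (expWeight ρ (α / m)) μ ν +
            ENNReal.ofReal (φt t) * (∫⁻ u, f u ∂ν) * ENNReal.ofReal ε)) := by
    intro ε hε
    obtain ⟨θ, hθ, hgθ⟩ := hginf ε hε
    have hG : ENNReal.ofReal (g θ) ≤ ENNReal.ofReal ε := ENNReal.ofReal_le_ofReal hgθ.le
    refine (wassLike_le_of_triangle hCa (hmeas _) (hmeas _) (hmeas _) htria _
      (μ.bind (P θ t)) _).trans ?_
    gcongr
    · refine (wassLike_comm_le (expWeight_symm hsymm _) (hmeas _) _ _).trans ?_
      refine (herr _ hbα θ μ ‹_›).trans ?_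
      gcongr
    · refine (wassLike_le_of_triangle hCb (hmeas _) (hmeas _) (hmeas _) htrib _
        (ν.bind (P θ t)) _).trans ?_
      gcongr
      · exact hcontr θ hθ t ht μ ν ‹_› ‹_›
      · refine (herr _ hbβ θ ν ‹_›).trans ?_
        gcongr
  obtain ⟨hfμ, hfν⟩ := ENNReal.add_lt_top.1 hfin
  have hε : Tendsto ENNReal.ofReal (𝓝[>] 0) (𝓝 0) :=
    tendsto_nhdsWithin_of_tendsto_nhds (by simpa using ENNReal.continuous_ofReal.tendsto 0)
  have hsmall : ∀ M : ℝ≥0∞, M < ⊤ →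
      Tendsto (fun ε : ℝ => ENNReal.ofReal (φt t) * M * ENNReal.ofReal ε) (𝓝[>] 0) (𝓝 0) := by
    intro M hM
    simpa using ENNReal.Tendsto.const_mul hε
      (Or.inr (ENNReal.mul_lt_top ENNReal.ofReal_lt_top hM).ne)
  have hlim := ENNReal.Tendsto.const_mul (a := ENNReal.ofReal Ca)
    ((hsmall _ hfμ).add (ENNReal.Tendsto.const_mul (a := ENNReal.ofReal Cb)
      ((tendsto_const_nhds (x := ENNReal.ofReal (C₁ * Real.exp (-C₂ * t)) *
        wassLike (expWeight ρ (α / m)) μ ν)).add (hsmall _ hfν))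
      (Or.inr ENNReal.ofReal_ne_top))) (Or.inr ENNReal.ofReal_ne_top)
  refine (ge_of_tendsto hlim (eventually_nhdsWithin_of_forall hstep)).trans (le_of_eq ?_)
  rw [zero_add, add_zero, mul_assoc (Ca * Cb),
    ENNReal.ofReal_mul (p := Ca * Cb) (by positivity),
    ENNReal.ofReal_mul hCa.le, mul_assoc, mul_assoc]
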